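/- Let T be a locally finite tree, let G ≤ Aut(T) be a closed, non-compact subgroup with Tits' independence property, and let (π, ℋ) be a unitary representation of G. Assume there exist a sequence (g_n) in G and a vector v ∈ ℋ such that g_n → ∞ and π(g_n)v converges weakly to a nonzero vector v₀ ∈ ℋ. If moreover the stabilizer G_{v₀} = {g ∈ G : π(g)v₀ = v₀} is non-compact and contains no hyperbolic elements, then G_{v₀} = G_ξ⁰ for some end ξ ∈ ∂T. -/

import Mathlib

open Filter Topology
open scoped InnerProductSpace

namespace TreeHM

variable {V : Type}

/-! ### The automorphism group of a graph, with the topology of pointwise convergence -/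

noncomputable instance autTopologicalSpace (T : SimpleGraph V) : TopologicalSpace (T ≃g T) :=
  letI : TopologicalSpace V := ⊥
  TopologicalSpace.induced (fun (g : T ≃g T) (x : V) => g x) inferInstance

/-- A graph automorphism preserves the combinatorial distance. -/
theorem iso_dist_le (T : SimpleGraph V) (g : T ≃g T) (u v : V) :
    T.dist (g u) (g v) ≤ T.dist u v := by
  by_cases h : T.Reachable u v
  · obtain ⟨p, hp⟩ := h.exists_walk_length_eq_dist
    calc T.dist (g u) (g v) ≤ (p.map g.toHom).length := SimpleGraph.dist_le _
      _ = p.length := SimpleGraph.Walk.length_map _ _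
      _ = T.dist u v := hp
  · rw [SimpleGraph.dist_eq_zero_of_not_reachable h,
      SimpleGraph.dist_eq_zero_of_not_reachable]
    intro hr
    have := hr.map g.symm.toHom
    exact h (by simpa using this)

theorem iso_dist_eq (T : SimpleGraph V) (g : T ≃g T) (u v : V) :
    T.dist (g u) (g v) = T.dist u v := by
  refine le_antisymm (iso_dist_le T g u v) ?_
  have := iso_dist_le T g⁻¹ (g u) (g v)
  simpa using this

/-- The tree `T` is locally finite. -/
def LocFin (T : SimpleGraph V) : Prop := ∀ x : V, (T.neighborSet x).Finite

/-- The graph `T` is `d`-regular: every vertex has exactly `d` neighbours. -/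
def Regular (T : SimpleGraph V) (d : ℕ) : Prop := ∀ x : V, (T.neighborSet x).ncard = d

/-! ### Geodesic rays and ends -/

/-- A geodesic ray in a graph; for a tree, the ends `∂T` are the equivalence classes of
geodesic rays under the relation `RayEquiv` of sharing a common subray.  Throughout, an end
`ξ ∈ ∂T` is represented by a geodesic ray, and equality of ends is `RayEquiv`. -/
structure GeodRay (T : SimpleGraph V) : Type where
  seq : ℕ → V
  adj : ∀ n, T.Adj (seq n) (seq (n + 1))
  geodesic : ∀ m n, T.dist (seq m) (seq n) = Nat.dist m n

/-- A bi-infinite geodesic line in a graph. -/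
structure GeodLine (T : SimpleGraph V) : Type where
  seq : ℤ → V
  adj : ∀ n, T.Adj (seq n) (seq (n + 1))
  geodesic : ∀ m n, T.dist (seq m) (seq n) = (m - n).natAbs

/-- Two geodesic rays are equivalent (define the same end) iff they share a common subray. -/
def RayEquiv (T : SimpleGraph V) (r s : GeodRay T) : Prop :=
  ∃ k l : ℕ, ∀ n : ℕ, r.seq (k + n) = s.seq (l + n)

/-- The image of a geodesic ray under an automorphism. -/
def mapRay (T : SimpleGraph V) (g : T ≃g T) (r : GeodRay T) : GeodRay T where
  seq := fun n => g (r.seq n)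
  adj := fun n => g.map_adj_iff.mpr (r.adj n)
  geodesic := fun m n => by rw [iso_dist_eq]; exact r.geodesic m n

/-- `g` fixes the end represented by the ray `r`. -/
def FixesEnd (T : SimpleGraph V) (g : T ≃g T) (r : GeodRay T) : Prop :=
  RayEquiv T (mapRay T g r) r

/-- A sequence of vertices converges to the end represented by the geodesic ray `r`:
for every `m`, the vertex `r.seq m` eventually lies on the geodesic from `r.seq 0` to `y n`,
i.e. the common initial segment of `[r.seq 0, y n]` and the ray tends to infinity. -/
def TendstoEnd (T : SimpleGraph V) (y : ℕ → V) (r : GeodRay T) : Prop :=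
  ∀ m : ℕ, ∀ᶠ n in atTop, T.dist (r.seq 0) (y n) = m + T.dist (r.seq m) (y n)

/-! ### Translation length and hyperbolic automorphisms -/

/-- The translation length `|g| = min_x dist(x, g x)` of an automorphism. -/
noncomputable def transLen (T : SimpleGraph V) (g : T ≃g T) : ℕ :=
  sInf (Set.range fun x : V => T.dist x (g x))

/-- `g` is hyperbolic iff its translation length is positive. -/
def IsHyperbolic (T : SimpleGraph V) (g : T ≃g T) : Prop := 0 < transLen T g

/-- The set `Min(g)` of vertices realizing the translation length; for a hyperbolic
automorphism of a tree this is its translation axis. -/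
def MinSet (T : SimpleGraph V) (g : T ≃g T) : Set V :=
  {x : V | T.dist x (g x) = transLen T g}

/-- The ray `r` (based at the axis) represents the attracting end of `a`:
the orbit `a^n x` converges to this end. -/
def IsAttractingEnd (T : SimpleGraph V) (a : T ≃g T) (r : GeodRay T) : Prop :=
  TendstoEnd T (fun n : ℕ => (a ^ n) (r.seq 0)) r

/-! ### Half-trees and Tits' independence property -/

/-- The half-tree determined by an oriented edge `(a, b)` of a tree:  all vertices `y`
lying on the side of `a`, i.e. whose geodesic to `b` passes through `a`. -/
def EdgeSide (T : SimpleGraph V) (a b : V) : Set V :=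
  {y : V | T.dist b y = T.dist a y + 1}

/-- The half-tree emanating from the base vertex `r.seq 0` of a ray `r` and containing the
end of `r` in its boundary. -/
def RaySide (T : SimpleGraph V) (r : GeodRay T) : Set V :=
  {y : V | y = r.seq 0 ∨ T.dist (r.seq 0) y = 1 + T.dist (r.seq 1) y}

/-- Tits' independence property for a subgroup `G ≤ Aut(T)`:  for every edge `e = (a, b)`,
the pointwise stabilizer `G_e` decomposes as `G_{T₁} · G_{T₂}`, where `T₁, T₂` are the two
half-trees emanating from `e` and `G_{Tᵢ}` is the pointwise stabilizer of `Tᵢ`. -/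
def TitsIndep (T : SimpleGraph V) (G : Subgroup (T ≃g T)) : Prop :=
  ∀ a b : V, T.Adj a b → ∀ g ∈ G, g a = a → g b = b →
    ∃ g₁ ∈ G, ∃ g₂ ∈ G, g = g₁ * g₂ ∧
      (∀ y ∈ EdgeSide T a b, g₁ y = y) ∧ (∀ y ∈ EdgeSide T b a, g₂ y = y)

/-! ### Stabilizers and contraction groups -/

/-- The subgroup `G_ξ⁰ = {g ∈ G : g ξ = ξ and g fixes some vertex}`, as a subset of `G`. -/
def EndStab0 (T : SimpleGraph V) (G : Subgroup (T ≃g T)) (ξ : GeodRay T) : Set G :=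
  {g : G | FixesEnd T (g : T ≃g T) ξ ∧ ∃ x : V, (g : T ≃g T) x = x}

/-- The contraction group `U⁺_α` of a sequence `α` in `G`. -/
def ContrSeq {G : Type} [Group G] [TopologicalSpace G] (α : ℕ → G) : Set G :=
  {g : G | Tendsto (fun n : ℕ => (α n)⁻¹ * g * α n) atTop (𝓝 1)}

/-- The contraction group `U⁺_a = {g : a⁻ⁿ g aⁿ → 1}` of an element `a` of `G`. -/
def Upos {G : Type} [Group G] [TopologicalSpace G] (a : G) : Set G :=
  ContrSeq (fun n : ℕ => a ^ n)

/-- The contraction group `U⁻_a = {g : aⁿ g a⁻ⁿ → 1}` of an element `a` of `G`. -/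
def Uneg {G : Type} [Group G] [TopologicalSpace G] (a : G) : Set G :=
  ContrSeq (fun n : ℕ => (a ^ n)⁻¹)

/-! ### Unitary representations and the Howe–Moore property -/

/-- A (strongly continuous) unitary representation of a topological group `G` on a complex
inner product space `H`. -/
structure UnitaryRep (G : Type) [Group G] [TopologicalSpace G]
    (H : Type) [NormedAddCommGroup H] [InnerProductSpace ℂ H] where
  ρ : G →* (H ≃ₗᵢ[ℂ] H)
  strong_continuity : ∀ v : H, Continuous fun g : G => ρ g v

/-- The representation `π` has no nonzero `G`-invariant vector. -/
def NoInvariantVectors {G : Type} [Group G] [TopologicalSpace G]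
    {H : Type} [NormedAddCommGroup H] [InnerProductSpace ℂ H]
    (π : UnitaryRep G H) : Prop :=
  ∀ v : H, (∀ g : G, π.ρ g v = v) → v = 0

/-- The Howe–Moore property: every unitary representation without nonzero invariant vectors
has all its matrix coefficients vanishing at infinity. -/
def HasHoweMoore (G : Type) [Group G] [TopologicalSpace G] : Prop :=
  ∀ (H : Type) [NormedAddCommGroup H] [InnerProductSpace ℂ H] [CompleteSpace H]
    (π : UnitaryRep G H), NoInvariantVectors π →
      ∀ v w : H, Tendsto (fun g : G => ⟪π.ρ g v, w⟫_ℂ) (cocompact G) (𝓝 0)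

/-! ### Legal colorings and the universal groups of Burger–Mozes -/

/-- A legal coloring of a `d`-regular tree: a coloring of the (unoriented) edges by
`{1, …, d}` whose restriction to the star of each vertex is a bijection onto `{1, …, d}`.
The color of the edge `{x, y}` is recorded as `color x y` with `color x y = color y x`. -/
structure LegalColoring (T : SimpleGraph V) (d : ℕ) where
  color : V → V → Fin d
  symm : ∀ x y : V, T.Adj x y → color x y = color y x
  injOn : ∀ x : V, Set.InjOn (color x) (T.neighborSet x)
  surjOn : ∀ x : V, Set.SurjOn (color x) (T.neighborSet x) Set.univ

/-- Membership in the universal group `U(F)`: at every vertex `x` the local action of `g`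
on colors is given by an element of `F`. -/
def InUF {d : ℕ} (T : SimpleGraph V) (F : Subgroup (Equiv.Perm (Fin d)))
    (ι : LegalColoring T d) (g : T ≃g T) : Prop :=
  ∀ x : V, ∃ σ ∈ F, ∀ y : V, T.Adj x y → σ (ι.color x y) = ι.color (g x) (g y)

/-- The universal group `U(F)⁺`: the subgroup of `Aut(T)` generated by the elements of
`U(F)` fixing (pointwise) an edge of `T`. -/
def UFplus {d : ℕ} (T : SimpleGraph V) (F : Subgroup (Equiv.Perm (Fin d)))
    (ι : LegalColoring T d) : Subgroup (T ≃g T) :=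
  Subgroup.closure
    {g : T ≃g T | InUF T F ι g ∧ ∃ x y : V, T.Adj x y ∧ g x = x ∧ g y = y}

/-! ### Permutation group conditions -/

/-- `F` acts transitively on `{1, …, d}`. -/
def PermTransitive {d : ℕ} (F : Subgroup (Equiv.Perm (Fin d))) : Prop :=
  ∀ i j : Fin d, ∃ σ ∈ F, σ i = j

/-- `F` acts 2-transitively on `{1, …, d}`. -/
def PermTwoTransitive {d : ℕ} (F : Subgroup (Equiv.Perm (Fin d))) : Prop :=
  ∀ a b c e : Fin d, a ≠ b → c ≠ e → ∃ σ ∈ F, σ a = c ∧ σ b = e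

/-- `F` acts primitively on `{1, …, d}`: it is transitive and every block of the action
is trivial (a subsingleton or the whole set). -/
def PermPrimitive {d : ℕ} (F : Subgroup (Equiv.Perm (Fin d))) : Prop :=
  PermTransitive F ∧
    ∀ B : Set (Fin d),
      (∀ σ ∈ F, (σ : Equiv.Perm (Fin d)) '' B = B ∨
        Disjoint ((σ : Equiv.Perm (Fin d)) '' B) B) →
      B.Subsingleton ∨ B = Set.univ

/-- `F` is a cyclic group of prime order. -/
def CyclicOfPrimeOrder {d : ℕ} (F : Subgroup (Equiv.Perm (Fin d))) : Prop :=
  IsCyclic F ∧ (Nat.card F).Prime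

/-- `F` is generated by its point stabilizers `F_i = {σ ∈ F : σ i = i}`. -/
def GenByPointStabilizers {d : ℕ} (F : Subgroup (Equiv.Perm (Fin d))) : Prop :=
  F = Subgroup.closure {σ : Equiv.Perm (Fin d) | σ ∈ F ∧ ∃ i : Fin d, σ i = i}


/-! ### Auxiliary facts on trees -/

/-- `b` lies on the geodesic from `a` to `c`. -/
def Btw (T : SimpleGraph V) (a b c : V) : Prop := T.dist a b + T.dist b c = T.dist a c

theorem exists_btw (T : SimpleGraph V) (hT : T.IsTree) (y z : V) (k : ℕ) (hk : k ≤ T.dist y z) :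
    ∃ w, Btw T y w z ∧ T.dist y w = k := by
  obtain ⟨p, hp⟩ := hT.1.exists_walk_length_eq_dist y z
  have h1 : T.dist y (p.getVert k) ≤ k := by
    refine (SimpleGraph.dist_le (p.take k)).trans ?_
    simp
  have h2 : T.dist (p.getVert k) z ≤ T.dist y z - k := by
    refine (SimpleGraph.dist_le (p.drop k)).trans ?_
    simp [hp]
  have h3 := hT.1.dist_triangle (u := y) (v := p.getVert k) (w := z)
  refine ⟨p.getVert k, ?_, ?_⟩ <;> unfold Btw at * <;> omega

theorem btw_unique (T : SimpleGraph V) (hT : T.IsTree) {y z a b : V} (ha : Btw T y a z)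
    (hb : Btw T y b z) (h : T.dist y a = T.dist y b) : a = b := by
  obtain ⟨p1, hp1⟩ := hT.1.exists_walk_length_eq_dist y a
  obtain ⟨p2, hp2⟩ := hT.1.exists_walk_length_eq_dist a z
  obtain ⟨q1, hq1⟩ := hT.1.exists_walk_length_eq_dist y b
  obtain ⟨q2, hq2⟩ := hT.1.exists_walk_length_eq_dist b z
  unfold Btw at ha hb
  have hP : (p1.append p2).IsPath := by
    apply SimpleGraph.Walk.isPath_of_length_eq_dist
    rw [SimpleGraph.Walk.length_append]; omega
  have hQ : (q1.append q2).IsPath := by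
    apply SimpleGraph.Walk.isPath_of_length_eq_dist
    rw [SimpleGraph.Walk.length_append]; omega
  have e : p1.append p2 = q1.append q2 := (hT.existsUnique_path y z).unique hP hQ
  have h1 : (p1.append p2).getVert (T.dist y a) = a := by
    simp [SimpleGraph.Walk.getVert_append, hp1]
  have h2 : (q1.append q2).getVert (T.dist y a) = b := by
    simp [SimpleGraph.Walk.getVert_append, hq1, h]
  rw [← h1, ← h2, e]

theorem btw_symm {T : SimpleGraph V} {a b c : V} (h : Btw T a b c) : Btw T c b a := by
  unfold Btw at *
  rw [T.dist_comm (u := c) (v := b), T.dist_comm (u := b) (v := a), T.dist_comm (u := c) (v := a)]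
  omega

theorem btw_map {T : SimpleGraph V} (g : T ≃g T) {a b c : V} (h : Btw T a b c) :
    Btw T (g a) (g b) (g c) := by
  unfold Btw at *
  simpa only [iso_dist_eq] using h

/-- transitivity: `b ∈ [a,c]`, `c ∈ [a,d]` -/
theorem btw_trans {T : SimpleGraph V} (hT : T.IsTree) {a b c d : V} (h : Btw T a b c)
    (h' : Btw T a c d) : Btw T a b d ∧ Btw T b c d := by
  have h1 := hT.1.dist_triangle (u := b) (v := c) (w := d)
  have h2 := hT.1.dist_triangle (u := a) (v := b) (w := d)
  unfold Btw at *
  omega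

/-- points on a geodesic are ordered -/
theorem btw_order {T : SimpleGraph V} (hT : T.IsTree) {y z a b : V} (ha : Btw T y a z)
    (hb : Btw T y b z) (h : T.dist y a ≤ T.dist y b) : Btw T y a b := by
  obtain ⟨w, hw, hw'⟩ := exists_btw T hT y b _ h
  have := btw_unique T hT ha (btw_trans hT hw hb).1 hw'.symm
  rwa [this]

theorem dist_step {T : SimpleGraph V} (hT : T.IsTree) {a b : V} (h : T.dist a b = 1) (z : V) :
    T.dist a z = T.dist b z + 1 ∨ T.dist b z = T.dist a z + 1 := by
  have := hT.dist_eq_dist_add_one_of_adj z (SimpleGraph.dist_eq_one_iff_adj.1 h)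
  rwa [T.dist_comm (u := z), T.dist_comm (u := z)] at this

theorem dist_up {T : SimpleGraph V} (hT : T.IsTree) (y z : V) : ∀ (n : ℕ) (c u : V),
    T.dist u y = n → T.dist c y = n + 1 → T.dist c u = 1 → T.dist u z = T.dist c z + 1 →
    T.dist y z = T.dist c z + 1 + n := by
  intro n
  induction n with
  | zero =>
    intro c u h1 h2 h3 h4
    have : u = y := (hT.1.dist_eq_zero_iff).1 h1
    subst this
    omega
  | succ n ih =>
    intro c u h1 h2 h3 h4
    obtain ⟨u', hu, hu'⟩ := exists_btw T hT u y 1 (by omega)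
    have hu2 : T.dist u' y = n := by unfold Btw at hu; omega
    rcases dist_step hT hu' z with h | h
    · exfalso
      have : u' = c := by
        apply btw_unique T hT (y := u) (z := z)
        · unfold Btw; omega
        · unfold Btw
          rw [T.dist_comm (u := u) (v := c)]; omega
        · rw [T.dist_comm (u := u) (v := c)]; omega
      subst this
      omega
    · have := ih u u' hu2 h1 hu' h
      omega

theorem exists_median {T : SimpleGraph V} (hT : T.IsTree) (x y z : V) :
    ∃ c, Btw T x c y ∧ Btw T x c z ∧ Btw T y c z := by
  have hne : ∃ k, ∃ c, Btw T x c y ∧ Btw T x c z ∧ T.dist c y = k :=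
    ⟨_, x, by simp [Btw], by simp [Btw], rfl⟩
  classical
  obtain ⟨c, h1, h2, h3⟩ := Nat.find_spec hne
  refine ⟨c, h1, h2, ?_⟩
  by_cases h0 : T.dist c y = 0
  · have : c = y := (hT.1.dist_eq_zero_iff).1 h0
    subst this; simp [Btw]
  obtain ⟨u, hu, hu'⟩ := exists_btw T hT c y 1 (by omega)
  have hu2 : T.dist u y + 1 = T.dist c y := by unfold Btw at hu; omega
  have hxu := btw_trans hT (btw_symm hu) (btw_symm h1)
  rcases dist_step hT hu' z with h | h
  · exfalso
    apply Nat.find_min hne (m := T.dist u y) (by omega)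
    refine ⟨u, btw_symm hxu.1, ?_, rfl⟩
    have := btw_symm hxu.2
    unfold Btw at *
    omega
  · have := dist_up hT y z (T.dist u y) c u rfl hu2.symm hu' h
    unfold Btw
    rw [T.dist_comm (u := y) (v := c)]
    omega

/-- midpoint lemma for elliptic automorphisms -/
theorem exists_mid {T : SimpleGraph V} (hT : T.IsTree) (t : T ≃g T) {q : V} (hq : t q = q)
    (y : V) : ∃ m, t m = m ∧ Btw T y m q ∧ Btw T y m (t y) ∧ T.dist y (t y) = 2 * T.dist y m := by
  obtain ⟨c, h1, h2, h3⟩ := exists_median hT q y (t y)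
  have h4 := btw_map t h1
  rw [hq] at h4
  have hd : T.dist q (t c) = T.dist q c := by
    conv_lhs => rw [← hq]
    exact iso_dist_eq T t q c
  have hc : t c = c := btw_unique T hT h4 h2 hd
  refine ⟨c, hc, btw_symm h1, h3, ?_⟩
  have h5 := iso_dist_eq T t c y
  rw [hc, T.dist_comm (u := c) (v := y)] at h5
  unfold Btw at h3
  omega

/-- Serre's lemma. -/
theorem common_fix {T : SimpleGraph V} (hT : T.IsTree) (s t : T ≃g T) (hs : ∃ q, s q = q)
    (ht : ∃ q, t q = q) (hst : ∃ q, (s * t) q = q) : ∃ q, s q = q ∧ t q = q := by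
  obtain ⟨q1, h1⟩ := hs
  obtain ⟨q2, h2⟩ := ht
  obtain ⟨y, hy⟩ := hst
  replace hy : s (t y) = y := hy
  obtain ⟨m1, a1, -, a3, a4⟩ := exists_mid hT t h2 y
  obtain ⟨m2, b1, -, b3, b4⟩ := exists_mid hT s h1 (t y)
  rw [hy] at b3 b4
  rw [T.dist_comm] at b4
  have b5 := btw_symm b3
  have : m1 = m2 := by
    apply btw_unique T hT a3 b5
    unfold Btw at b5
    rw [T.dist_comm (u := m2)] at b5
    omega
  subst this
  exact ⟨m1, b1, a1⟩

theorem key {T : SimpleGraph V} (hT : T.IsTree) (s t : T ≃g T) (hs : ∃ q, s q = q)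
    (ht : ∃ q, t q = q) (hst : ∃ q, (s * t) q = q) (x w : V) (hw : Btw T x w (s x))
    (hw2 : 2 * T.dist x w ≤ T.dist x (s x)) :
    (2 * T.dist x w ≤ T.dist x (t x) → Btw T x w (t x)) ∧
    (T.dist x (t x) ≤ 2 * T.dist x w → t w = w) := by
  obtain ⟨q, hq1, hq2⟩ := common_fix hT s t hs ht hst
  obtain ⟨p, a1, a2, a3, a4⟩ := exists_mid hT s hq1 x
  obtain ⟨p', b1, b2, b3, b4⟩ := exists_mid hT t hq2 x
  have c1 : Btw T x w p := btw_order hT hw a3 (by omega)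
  have c2 : Btw T x w q := (btw_trans hT c1 a2).1
  constructor
  · intro h
    exact (btw_trans hT (btw_order hT c2 b2 (by omega)) b3).1
  · intro h
    have c3 : Btw T x p' w := btw_order hT b2 c2 (by omega)
    have c4 : Btw T p' w q := (btw_trans hT c3 c2).2
    have c5 := btw_map t c4
    rw [b1, hq2] at c5
    refine btw_unique T hT c5 c4 ?_
    conv_lhs => rw [← b1]
    exact iso_dist_eq T t p' w

theorem exists_ray {T : SimpleGraph V} (hT : T.IsTree) (S : Set (T ≃g T))
    (hmul : ∀ s ∈ S, ∀ t ∈ S, s * t ∈ S) (hfix : ∀ s ∈ S, ∃ q, s q = q)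
    (hne : S.Nonempty) (hno : ¬ ∃ q, ∀ s ∈ S, s q = q) :
    ∃ (r : GeodRay T) (s : ℕ → (T ≃g T)), (∀ n, s n ∈ S) ∧
      (∀ n, Btw T (r.seq 0) (r.seq n) (s n (r.seq 0))) ∧
      (∀ n, 2 * n ≤ T.dist (r.seq 0) (s n (r.seq 0))) ∧
      (∀ t ∈ S, ∃ N, ∀ n ≥ N, t (r.seq n) = r.seq n) := by
  obtain ⟨x⟩ : Nonempty V := hT.1.nonempty
  have hunb : ∀ n, ∃ s ∈ S, 2 * n ≤ T.dist x (s x) := by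
    by_contra hcon
    push Not at hcon
    obtain ⟨n, hn⟩ := hcon
    apply hno
    have hfin : ((fun s : T ≃g T => T.dist x (s x)) '' S).Finite := by
      apply (Set.finite_lt_nat (2 * n)).subset
      rintro _ ⟨s, hs, rfl⟩
      exact hn s hs
    obtain ⟨_, ⟨s, hs, rfl⟩, hmax⟩ := Set.exists_max_image _ id hfin (hne.image _)
    obtain ⟨q, hq⟩ := hfix s hs
    obtain ⟨m, a1, a2, a3, a4⟩ := exists_mid hT s hq x
    refine ⟨m, fun t ht => ?_⟩
    refine (key hT s t (hfix s hs) (hfix t ht) (hfix _ (hmul s hs t ht)) x m a3 a4.ge).2 ?_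
    have := hmax _ ⟨t, ht, rfl⟩
    simp only [id] at this
    omega
  choose s hs hs2 using hunb
  have hr : ∀ n, ∃ w, Btw T x w (s n x) ∧ T.dist x w = n := fun n =>
    exists_btw T hT x (s n x) n (by have := hs2 n; omega)
  choose r hr1 hr2 using hr
  have hkey : ∀ n, ∀ t ∈ S, (2 * n ≤ T.dist x (t x) → Btw T x (r n) (t x)) ∧
      (T.dist x (t x) ≤ 2 * n → t (r n) = r n) := by
    intro n t ht
    have := key hT (s n) t (hfix _ (hs n)) (hfix t ht) (hfix _ (hmul _ (hs n) t ht)) x (r n)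
      (hr1 n) (by rw [hr2]; exact hs2 n)
    rwa [hr2] at this
  have hmn : ∀ m n, m ≤ n → T.dist (r m) (r n) = n - m := by
    intro m n h
    have h1 := (hkey m (s n) (hs n)).1 (by have := hs2 n; omega)
    have h2 := btw_order hT h1 (hr1 n) (by rw [hr2, hr2]; exact h)
    unfold Btw at h2
    rw [hr2, hr2] at h2
    omega
  have hr0 : r 0 = x := ((hT.1.dist_eq_zero_iff).1 (hr2 0)).symm
  refine ⟨⟨r, fun n => ?_, fun m n => ?_⟩, s, hs, ?_, ?_, ?_⟩
  · rw [← SimpleGraph.dist_eq_one_iff_adj, hmn _ _ (Nat.le_succ n)]; omega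
  · rcases le_total m n with h | h
    · rw [hmn _ _ h, Nat.dist_eq_sub_of_le h]
    · rw [T.dist_comm, hmn _ _ h, Nat.dist_eq_sub_of_le_right h]
  · simpa only [hr0] using hr1
  · simpa only [hr0] using hs2
  · intro t ht
    exact ⟨T.dist x (t x), fun n hn => (hkey n t ht).2 (by omega)⟩

theorem ray_dist {T : SimpleGraph V} (r : GeodRay T) {m n : ℕ} (h : m ≤ n) :
    T.dist (r.seq m) (r.seq n) = n - m := by
  rw [r.geodesic, Nat.dist_eq_sub_of_le h]

/-- distances to a ray eventually grow linearly -/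
theorem ray_away {T : SimpleGraph V} (hT : T.IsTree) (r : GeodRay T) (y : V) :
    ∃ N, ∀ n ≥ N, T.dist (r.seq (n + 1)) y = T.dist (r.seq n) y + 1 := by
  classical
  have hstep : ∀ n, T.dist (r.seq n) y = T.dist (r.seq (n + 1)) y + 1 ∨
      T.dist (r.seq (n + 1)) y = T.dist (r.seq n) y + 1 := fun n =>
    dist_step hT (by rw [ray_dist r (Nat.le_succ n)]; omega) y
  have h1 : ∃ N, T.dist (r.seq (N + 1)) y = T.dist (r.seq N) y + 1 := by
    by_contra hcon
    push Not at hcon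
    have : ∀ n, T.dist (r.seq n) y + n = T.dist (r.seq 0) y := by
      intro n
      induction n with
      | zero => simp
      | succ n ih =>
        have := hstep n
        have := hcon n
        omega
    have := this (T.dist (r.seq 0) y + 1)
    omega
  obtain ⟨N, hN⟩ := h1
  refine ⟨N, fun n hn => ?_⟩
  have := dist_up hT (r.seq (n + 1)) y (n - N) (r.seq N) (r.seq (N + 1))
    (by rw [ray_dist r (by omega)]; omega) (by rw [ray_dist r (by omega)]; omega)
    (by rw [ray_dist r (by omega)]; omega) hN
  rcases Nat.eq_or_lt_of_le hn with h | h
  · subst h; exact hN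
  · have h' := dist_up hT (r.seq n) y (n - N - 1) (r.seq N) (r.seq (N + 1))
      (by rw [ray_dist r (by omega)]; omega) (by rw [ray_dist r (by omega)]; omega)
      (by rw [ray_dist r (by omega)]; omega) hN
    omega

theorem fixes_tail {T : SimpleGraph V} (hT : T.IsTree) (r : GeodRay T) (g : T ≃g T)
    (h : FixesEnd T g r) {y : V} (hy : g y = y) : ∃ N, ∀ n ≥ N, g (r.seq n) = r.seq n := by
  obtain ⟨k, l, hkl⟩ := h
  replace hkl : ∀ n, g (r.seq (k + n)) = r.seq (l + n) := hkl
  obtain ⟨N, hN⟩ := ray_away hT r y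
  have hlin : ∀ i, T.dist (r.seq (N + i)) y = T.dist (r.seq N) y + i := by
    intro i
    induction i with
    | zero => simp
    | succ i ih => rw [← add_assoc, hN _ (by omega), ih]; omega
  have h1 : T.dist (r.seq (l + N)) y = T.dist (r.seq (k + N)) y := by
    rw [← hkl N]
    conv_lhs => rw [← hy]
    exact iso_dist_eq T g _ _
  rw [add_comm l, add_comm k, hlin, hlin] at h1
  have : l = k := by omega
  subst this
  refine ⟨l, fun n hn => ?_⟩
  have := hkl (n - l)
  rwa [Nat.add_sub_cancel' hn] at this

/-- if `u` is on the `b` side and `w` is on the `a` side then `d(a,u) ≤ d(u,w)` -/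
theorem side_cross {T : SimpleGraph V} (hT : T.IsTree) {a b u w : V} (hab : T.dist a b = 1)
    (hu : T.dist a u = T.dist b u + 1) (hw : T.dist b w = T.dist a w + 1) :
    T.dist a u ≤ T.dist u w := by
  obtain ⟨c, h1, h2, h3⟩ := exists_median hT a u w
  by_cases h : T.dist a c = 0
  · have : a = c := (hT.1.dist_eq_zero_iff).1 h
    subst this
    unfold Btw at h3
    rw [T.dist_comm (u := a)]
    omega
  · exfalso
    have hb : Btw T a b u := by unfold Btw; omega
    have := (btw_trans hT (btw_order hT hb h1 (by omega)) h2).1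
    unfold Btw at this
    omega

/-! ### Topology -/

theorem tendsto_one_of_eventually (T : SimpleGraph V) (G : Subgroup (T ≃g T)) (a : ℕ → G)
    (h : ∀ y : V, ∀ᶠ n in atTop, (a n : T ≃g T) y = y) : Tendsto a atTop (𝓝 1) := by
  letI : TopologicalSpace V := ⊥
  haveI : DiscreteTopology V := ⟨rfl⟩
  have hi : IsInducing (fun (g : T ≃g T) (x : V) => g x) := ⟨rfl⟩
  rw [tendsto_subtype_rng, hi.tendsto_nhds_iff, tendsto_pi_nhds]
  intro y
  rw [nhds_discrete, tendsto_pure]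
  exact h y

theorem sphere_finite {T : SimpleGraph V} (hT : T.IsTree) (hlf : LocFin T) (x : V) (n : ℕ) :
    {y | T.dist x y = n}.Finite := by
  induction n with
  | zero =>
    apply (Set.finite_singleton x).subset
    intro y hy
    exact ((hT.1.dist_eq_zero_iff).1 hy).symm
  | succ n ih =>
    apply (ih.biUnion (fun y _ => hlf y)).subset
    intro y hy
    replace hy : T.dist x y = n + 1 := hy
    obtain ⟨w, hw, hw'⟩ := exists_btw T hT x y n (by omega)
    simp only [Set.mem_iUnion]
    refine ⟨w, hw', ?_⟩
    rw [SimpleGraph.mem_neighborSet, ← SimpleGraph.dist_eq_one_iff_adj]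
    unfold Btw at hw
    omega

theorem stab_compact {T : SimpleGraph V} (hT : T.IsTree) (hlf : LocFin T) (x : V) :
    IsCompact {g : T ≃g T | g x = x} := by
  letI : TopologicalSpace V := ⊥
  haveI : DiscreteTopology V := ⟨rfl⟩
  have hi : IsInducing (fun (g : T ≃g T) (x : V) => g x) := ⟨rfl⟩
  rw [hi.isCompact_iff]
  have hK : IsCompact (Set.pi Set.univ (fun y : V => {z | T.dist x z = T.dist x y})) :=
    isCompact_univ_pi fun y => (sphere_finite hT hlf x _).isCompact
  refine hK.of_isClosed_subset ?_ ?_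
  · refine isClosed_of_closure_subset ?_
    intro f hf
    have happ : ∀ y z : V, ∃ g : T ≃g T, g x = x ∧ g y = f y ∧ g z = f z := by
      intro y z
      have ho : IsOpen {f' : V → V | f' y = f y ∧ f' z = f z} :=
        ((isOpen_discrete {f y}).preimage (continuous_apply (A := fun _ : V => V) y)).inter
          ((isOpen_discrete {f z}).preimage (continuous_apply (A := fun _ : V => V) z))
      obtain ⟨_, ⟨h1, h2⟩, g, hg, rfl⟩ := mem_closure_iff.1 hf _ ho ⟨rfl, rfl⟩
      exact ⟨g, hg, h1, h2⟩
    have hfd : ∀ y, T.dist x (f y) = T.dist x y := by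
      intro y
      obtain ⟨g, h1, h2, -⟩ := happ y y
      rw [← h2]
      conv_lhs => rw [← h1]
      exact iso_dist_eq T g _ _
    have hinj : Function.Injective f := by
      intro y z hyz
      obtain ⟨g, -, h2, h3⟩ := happ y z
      exact g.injective (by rw [h2, h3, hyz])
    have hsurj : Function.Surjective f := by
      intro z
      have hfin := sphere_finite hT hlf x (T.dist x z)
      have hmaps : Set.MapsTo f {y | T.dist x y = T.dist x z} {y | T.dist x y = T.dist x z} :=
        fun y hy => (hfd y).trans hy
      have him : f '' {y | T.dist x y = T.dist x z} = {y | T.dist x y = T.dist x z} :=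
        Set.eq_of_subset_of_ncard_le hmaps.image_subset
          (Set.ncard_image_of_injective _ hinj).ge hfin
      have hz : z ∈ {y | T.dist x y = T.dist x z} := rfl
      rw [← him] at hz
      obtain ⟨y, -, hy⟩ := hz
      exact ⟨y, hy⟩
    refine ⟨⟨Equiv.ofBijective f ⟨hinj, hsurj⟩, ?_⟩, ?_, rfl⟩
    · intro y z
      obtain ⟨g, -, h2, h3⟩ := happ y z
      change T.Adj (f y) (f z) ↔ _
      rw [← h2, ← h3]
      exact g.map_adj_iff
    · obtain ⟨g, h1, h2, -⟩ := happ x x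
      exact h2.symm.trans h1
  · rintro _ ⟨g, hg, rfl⟩ y -
    change T.dist x (g y) = T.dist x y
    conv_lhs => rw [← (show g x = x from hg)]
    exact iso_dist_eq T g _ _

/-- In the setting of the strengthened Mautner phenomenon, if moreover
`G_{v₀}` is non-compact and contains no hyperbolic element, then `G_{v₀} = G_ξ⁰` for some
end `ξ ∈ ∂T`. -/
theorem stabilizer_eq_end_stabilizer_of_noncompact
    {V : Type} (T : SimpleGraph V) (hT : T.IsTree) (hlf : LocFin T)
    (G : Subgroup (T ≃g T)) (hclosed : IsClosed (G : Set (T ≃g T)))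
    (hnoncpt : ¬ IsCompact (G : Set (T ≃g T))) (htits : TitsIndep T G)
    (H : Type) [NormedAddCommGroup H] [InnerProductSpace ℂ H] [CompleteSpace H]
    (π : UnitaryRep G H)
    (g : ℕ → G) (v : H)
    (hinf : Tendsto g atTop (cocompact G))
    (v₀ : H) (hv₀ : v₀ ≠ 0)
    (hweak : ∀ w : H, Tendsto (fun n : ℕ => ⟪π.ρ (g n) v, w⟫_ℂ) atTop (𝓝 ⟪v₀, w⟫_ℂ))
    (hstabnc : ¬ IsCompact {h : G | π.ρ h v₀ = v₀})
    (hnohyp : ∀ h : G, π.ρ h v₀ = v₀ → ¬ IsHyperbolic T (h : T ≃g T)) :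
    ∃ ξ : GeodRay T, {h : G | π.ρ h v₀ = v₀} = EndStab0 T G ξ := by
  have hclS : IsClosed {h : G | π.ρ h v₀ = v₀} :=
    isClosed_eq (π.strong_continuity v₀) continuous_const
  have hfixG : ∀ h : G, π.ρ h v₀ = v₀ → ∃ q, (h : T ≃g T) q = q := by
    intro h hh
    have h0 : transLen T (h : T ≃g T) = 0 := by
      have := hnohyp h hh
      unfold IsHyperbolic at this
      omega
    obtain ⟨x₀⟩ : Nonempty V := hT.1.nonempty
    have hmem := Nat.sInf_mem (s := Set.range fun x : V => T.dist x ((h : T ≃g T) x)) ⟨_, x₀, rfl⟩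
    obtain ⟨q, hq⟩ := hmem
    refine ⟨q, ((hT.1.dist_eq_zero_iff).1 (hq.trans h0)).symm⟩
  let S : Set (T ≃g T) := Subtype.val '' {h : G | π.ρ h v₀ = v₀}
  have hno : ¬ ∃ q, ∀ s ∈ S, s q = q := by
    rintro ⟨q, hq⟩
    apply hstabnc
    have hc : IsCompact ((Subtype.val : G → (T ≃g T)) ⁻¹' {g : T ≃g T | g q = q}) :=
      hclosed.isClosedEmbedding_subtypeVal.isCompact_preimage (stab_compact hT hlf q)
    exact hc.of_isClosed_subset hclS fun h hh => hq _ ⟨h, hh, rfl⟩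
  obtain ⟨r, s, hsS, hs1, hs2, htail⟩ := exists_ray hT S
    (by
      rintro _ ⟨a, ha, rfl⟩ _ ⟨b, hb, rfl⟩
      refine ⟨a * b, ?_, rfl⟩
      change π.ρ (a * b) v₀ = v₀
      rw [map_mul]
      change π.ρ a (π.ρ b v₀) = v₀
      rw [show π.ρ b v₀ = v₀ from hb]
      exact ha)
    (by
      rintro _ ⟨a, ha, rfl⟩
      exact hfixG a ha)
    ⟨_, 1, by change π.ρ 1 v₀ = v₀; rw [map_one]; rfl, rfl⟩ hno
  choose σ hσ hσs using hsS
  replace hσ : ∀ n, π.ρ (σ n) v₀ = v₀ := hσ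
  have hone : ∀ a : ℕ → G, Tendsto a atTop (𝓝 1) →
      Tendsto (fun n => π.ρ (a n) v₀) atTop (𝓝 v₀) := by
    intro a ha
    have := ((π.strong_continuity v₀).tendsto 1).comp ha
    rw [map_one] at this
    exact this
  -- elements fixing a half-tree containing the end
  have hhalf : ∀ m (k : G), (∀ y ∈ EdgeSide T (r.seq (m + 1)) (r.seq m), (k : T ≃g T) y = y) →
      π.ρ k v₀ = v₀ := by
    intro m k hk
    have hlim : Tendsto (fun n => (σ n)⁻¹ * k * σ n) atTop (𝓝 1) := by
      apply tendsto_one_of_eventually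
      intro y
      filter_upwards [eventually_ge_atTop (m + 1 + T.dist (r.seq 0) y)] with n hn
      suffices hmem : (σ n : T ≃g T) y ∈ EdgeSide T (r.seq (m + 1)) (r.seq m) by
        have h1 := hk _ hmem
        change (σ n : T ≃g T)⁻¹ ((k : T ≃g T) ((σ n : T ≃g T) y)) = y
        rw [h1]
        exact (σ n : T ≃g T).symm_apply_apply y
      rw [hσs n]
      have hab : T.dist (r.seq m) (r.seq (m + 1)) = 1 := by
        rw [ray_dist r (Nat.le_succ m)]; omega
      have e0 := ray_dist r (Nat.zero_le n)
      have e1 := ray_dist r (Nat.zero_le m)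
      have e2 := ray_dist r (Nat.zero_le (m + 1))
      have e3 := ray_dist r (show m ≤ n by omega)
      have e4 := ray_dist r (show m + 1 ≤ n by omega)
      have b1 : Btw T (r.seq 0) (r.seq m) (r.seq n) := by unfold Btw; omega
      have b2 : Btw T (r.seq 0) (r.seq (m + 1)) (r.seq n) := by unfold Btw; omega
      have c1 := (btw_trans hT b1 (hs1 n)).1
      have c2 := (btw_trans hT b2 (hs1 n)).1
      have hd := hs2 n
      unfold Btw at c1 c2
      rcases dist_step hT hab (s n y) with h | h
      · exact h
      · exfalso
        have := side_cross hT (u := s n (r.seq 0)) hab (by omega) h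
        rw [iso_dist_eq] at this
        omega
    have h1 := hone _ hlim
    have h2 : ∀ n, ‖π.ρ ((σ n)⁻¹ * k * σ n) v₀ - v₀‖ = ‖π.ρ k v₀ - v₀‖ := by
      intro n
      rw [← (π.ρ (σ n)).norm_map, map_sub, hσ n]
      congr 2
      change (π.ρ (σ n) * π.ρ ((σ n)⁻¹ * k * σ n)) v₀ = _
      rw [← map_mul, show σ n * ((σ n)⁻¹ * k * σ n) = k * σ n by group, map_mul]
      change π.ρ k (π.ρ (σ n) v₀) = _
      rw [hσ n]
    have h3 := tendsto_iff_norm_sub_tendsto_zero.1 h1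
    simp only [h2] at h3
    have h4 := tendsto_nhds_unique h3 tendsto_const_nhds
    exact sub_eq_zero.1 (norm_eq_zero.1 h4.symm)
  refine ⟨r, Set.Subset.antisymm ?_ ?_⟩
  · intro h hh
    refine ⟨?_, hfixG h hh⟩
    obtain ⟨N, hN⟩ := htail _ ⟨h, hh, rfl⟩
    exact ⟨N, N, fun n => hN (N + n) (by omega)⟩
  · rintro h ⟨hend, y, hy⟩
    obtain ⟨N, hN⟩ := fixes_tail hT r _ hend hy
    have hdec : ∀ m, ∃ k : G, (∀ y ∈ EdgeSide T (r.seq (N + m)) (r.seq (N + m + 1)),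
        (k : T ≃g T) y = y) ∧ π.ρ k v₀ = π.ρ h v₀ := by
      intro m
      obtain ⟨g₁, hg₁, g₂, hg₂, he, f1, f2⟩ := htits _ _ (r.adj (N + m)) h h.2
        (hN _ (by omega)) (hN _ (by omega))
      refine ⟨⟨g₁, hg₁⟩, f1, ?_⟩
      have h2 := hhalf (N + m) ⟨g₂, hg₂⟩ f2
      have h3 : h = ⟨g₁, hg₁⟩ * ⟨g₂, hg₂⟩ := Subtype.ext he
      rw [h3, map_mul]
      change _ = π.ρ ⟨g₁, hg₁⟩ (π.ρ ⟨g₂, hg₂⟩ v₀)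
      rw [h2]
    choose k hk1 hk2 using hdec
    have hlim : Tendsto k atTop (𝓝 1) := by
      apply tendsto_one_of_eventually
      intro z
      obtain ⟨M, hM⟩ := ray_away hT r z
      filter_upwards [eventually_ge_atTop M] with n hn
      exact hk1 n z (hM _ (by omega))
    have h1 := hone _ hlim
    simp only [hk2] at h1
    exact tendsto_nhds_unique tendsto_const_nhds h1

end TreeHM
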